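/- Let p be a prime, P an H-cyclic p-group with centre Z, ζ : Z → ℂ^× a faithful character, and h_ζ the commutator form on V = P/Z. Suppose V = V₁ ⊕ V₂ where V₁, V₂ are nonzero subgroups of V orthogonal to each other with respect to h_ζ, and let Pᵢ be the inverse image of Vᵢ in P. Then: (1) every element of P₁ commutes with every element of P₂; (2) each Pᵢ is H-cyclic with centre Z; (3) the map π : P₁ × P₂ → P, (x₁,x₂) ↦ x₁x₂, is a surjective homomorphism with kernel {(z, z⁻¹) : z ∈ Z}; (4) if τᵢ denotes the unique irreducible representation of Pᵢ whose restriction to Z contains ζ, and τ the unique irreducible representation of P containing ζ, then τ ∘ π ≅ τ₁ ⊗ τ₂. -/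

import Mathlib

open CategoryTheory

/-- The inverse image in `P` of a subgroup of `P ⧸ center P`. -/
def centerPreimage {P : Type*} [Group P] (V : Subgroup (P ⧸ Subgroup.center P)) :
    Subgroup P :=
  Subgroup.comap (QuotientGroup.mk' (Subgroup.center P)) V

theorem FDRep.isIrreducible_of_simple {k : Type*} [Field k] {G : Type*} [Monoid G]
    (V : FDRep k G) [Simple V] : Representation.IsIrreducible V.ρ := by
  have mono_or (S : Subrepresentation V.ρ) : S = ⊥ ∨ S = ⊤ := by
    let i : FDRep.of S.toRepresentation ⟶ V :=
      ⟨InducedCategory.homMk (ModuleCat.ofHom S.toSubmodule.subtype), fun g ↦ by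
        ext1
        ext x
        rfl⟩
    have hi : ∀ x : S.toSubmodule, i.hom x = (x : V) := fun x ↦ rfl
    have hmono : Mono i := by
      have : Mono i.hom := ConcreteCategory.mono_of_injective _ Subtype.val_injective
      exact (Action.forget (FGModuleCat k) G).mono_of_mono_map this
    by_cases h0 : i = 0
    · left
      refine Subrepresentation.toSubmodule_injective ((Submodule.eq_bot_iff _).2 fun x hx ↦ ?_)
      have := hi ⟨x, hx⟩
      rw [h0] at this
      exact this.symm
    · right
      have := isIso_of_mono_of_nonzero h0
      refine Subrepresentation.toSubmodule_injective ((Submodule.eq_top_iff').2 fun x ↦ ?_)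
      have hx : i.hom ((inv i).hom x) = x := by
        have := congrArg Action.Hom.hom (IsIso.inv_hom_id i)
        exact ConcreteCategory.congr_hom this x
      rw [← hx]
      exact Subtype.property ((inv i).hom x : S.toSubmodule)
  have hne : Nontrivial (Subrepresentation V.ρ) := by
    refine ⟨⊥, ⊤, fun h ↦ id_nonzero V ?_⟩
    ext x
    have : x ∈ (⊥ : Subrepresentation V.ρ).toSubmodule := h ▸ Submodule.mem_top (R := k)
    exact (Submodule.mem_bot k).1 this
  exact { eq_bot_or_eq_top := mono_or }

namespace Representation

/-- The central elements act on an irreducible representation by a linear character as soon as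
they do so on one nonzero vector. -/
theorem IsIrreducible.apply_center_eq_smul {k G V : Type*} [Field k] [Group G] [AddCommGroup V]
    [Module k V] {ρ : Representation k G V} (hρ : ρ.IsIrreducible) {ζ : Subgroup.center G → k}
    {v : V} (hv : v ≠ 0) (h : ∀ z : Subgroup.center G, ρ z v = ζ z • v)
    (z : Subgroup.center G) (w : V) : ρ z w = ζ z • w := by
  let S : Subrepresentation ρ :=
    { toSubmodule := LinearMap.ker (ρ z - ζ z • LinearMap.id)
      apply_mem_toSubmodule := fun g w hw ↦ by
        have hw : ρ z w = ζ z • w := by simpa [sub_eq_zero] using hw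
        have hz : ρ z (ρ g w) = ρ g (ρ z w) := by
          rw [← Module.End.mul_apply, ← Module.End.mul_apply, ← map_mul, ← map_mul,
            Subgroup.mem_center_iff.1 z.2 g]
        simp [hz, hw] }
  have hS : S = ⊤ := (eq_bot_or_eq_top S).resolve_left fun hb ↦ by
    have hvS : v ∈ S.toSubmodule := by simp [S, h]
    rw [hb] at hvS
    exact hv ((Submodule.mem_bot k).1 hvS)
  have hw : w ∈ S.toSubmodule := by rw [hS]; exact Submodule.mem_top (R := k)
  simpa [S, sub_eq_zero] using hw

section CentralCharacter

variable {k G V : Type*} [Field k] [Group G] [AddCommGroup V] [Module k V]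
  {ρ : Representation k G V} {ζ : Subgroup.center G →* kˣ}

theorem character_center
    [FiniteDimensional k V]
    (h : ∀ (z : Subgroup.center G) (w : V), ρ z w = (ζ z : k) • w)
    (z : Subgroup.center G) : ρ.character z = ζ z * Module.finrank k V := by
  have : ρ z = (ζ z : k) • LinearMap.id := LinearMap.ext (h z)
  rw [character, this, map_smul, LinearMap.trace_id, smul_eq_mul]

theorem character_eq_zero_of_notMem_center (hζ : Function.Injective ζ)
    (hcomm : ∀ x y : G, x * y * x⁻¹ * y⁻¹ ∈ Subgroup.center G)
    (h : ∀ (z : Subgroup.center G) (w : V), ρ z w = (ζ z : k) • w)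
    {x : G} (hx : x ∉ Subgroup.center G) : ρ.character x = 0 := by
  obtain ⟨y, hy⟩ : ∃ y, y * x ≠ x * y := by simpa [Subgroup.mem_center_iff] using hx
  set c : Subgroup.center G := ⟨y * x * y⁻¹ * x⁻¹, hcomm y x⟩ with hc
  have hc1 : c ≠ 1 := fun h1 ↦ hy <| by
    have h1 : y * x * y⁻¹ * x⁻¹ = 1 := congrArg Subtype.val h1
    rwa [mul_inv_eq_one, mul_inv_eq_iff_eq_mul] at h1
  have hcζ : (ζ c : k) ≠ 1 := fun h1 ↦ hc1 <| hζ <| by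
    rw [map_one]; exact Units.ext h1
  have hconj : ρ.character x = (ζ c : k) * ρ.character x := by
    have hmul : y * x * y⁻¹ = (c : G) * x := by simp [hc]
    have hρc : ρ c = (ζ c : k) • LinearMap.id := LinearMap.ext (h c)
    conv_lhs => rw [← char_conj ρ x y, hmul, character, map_mul, hρc]
    rw [smul_mul_assoc, map_smul, smul_eq_mul]
    rfl
  by_contra h0
  exact hcζ (mul_right_cancel₀ h0 (by rw [← hconj, one_mul]))

/-- The dimension formula `(dim ρ)² |Z| = |G|` for an irreducible representation with faithful
central character of a finite group of nilpotency class at most two. -/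
theorem IsIrreducible.finrank_sq_mul_card_center [IsAlgClosed k] [CharZero k] [Finite G]
    [FiniteDimensional k V] (hρ : ρ.IsIrreducible) (hζ : Function.Injective ζ)
    (hcomm : ∀ x y : G, x * y * x⁻¹ * y⁻¹ ∈ Subgroup.center G)
    (h : ∀ (z : Subgroup.center G) (w : V), ρ z w = (ζ z : k) • w) :
    Module.finrank k V ^ 2 * Nat.card (Subgroup.center G) = Nat.card G := by
  classical
  have := Fintype.ofFinite G
  have hG : (Nat.card G : k) ≠ 0 := Nat.cast_ne_zero.2 Nat.card_pos.ne'
  have := invertibleOfNonzero hG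
  have horth := char_orthonormal ρ ρ
  rw [if_pos ⟨Equiv.refl ρ⟩, inv_mul_eq_one₀ hG] at horth
  have hterm (g : G) : ρ.character g * ρ.character g⁻¹ =
      if g ∈ Subgroup.center G then (Module.finrank k V : k) ^ 2 else 0 := by
    split_ifs with hg
    · have h1 := character_center h ⟨g, hg⟩
      have h2 := character_center h ⟨g, hg⟩⁻¹
      rw [map_inv] at h2
      simp only [InvMemClass.coe_inv] at h1 h2
      rw [h1, h2, mul_mul_mul_comm, Units.mul_inv, one_mul, sq]
    · rw [character_eq_zero_of_notMem_center hζ hcomm h hg, zero_mul]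
  simp only [hterm, ← Finset.sum_filter, Finset.sum_const, nsmul_eq_mul] at horth
  have hcard : Nat.card (Subgroup.center G) =
      (Finset.univ.filter (· ∈ Subgroup.center G)).card := by
    rw [Nat.card_eq_fintype_card, Fintype.card_subtype]
  rw [hcard, mul_comm]
  exact_mod_cast horth.symm

end CentralCharacter

theorem IsIrreducible.comp_of_surjective {k G H V : Type*} [Field k] [Group G] [Group H]
    [AddCommGroup V] [Module k V] {ρ : Representation k G V} (hρ : ρ.IsIrreducible) {f : H →* G}
    (hf : Function.Surjective f) : IsIrreducible (ρ.comp f : Representation k H V) := by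
  let e : Subrepresentation ρ ≃o Subrepresentation (ρ.comp f : Representation k H V) :=
    { toFun S := ⟨S.toSubmodule, fun g _ hv ↦ S.apply_mem_toSubmodule (f g) hv⟩
      invFun S := ⟨S.toSubmodule, fun g v hv ↦ by
        obtain ⟨h, rfl⟩ := hf g
        exact S.apply_mem_toSubmodule h hv⟩
      map_rel_iff' := Iff.rfl }
  exact e.symm.isSimpleOrder

/-- An irreducible representation of `A × B`, for `A` and `B` finite of nilpotency class at most
two, on which the centre acts by a faithful character of each factor is isomorphic to the external
tensor product of irreducible representations of `A` and `B` with these central characters. -/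
theorem IsIrreducible.nonempty_equiv_tprod {k A B V V₁ V₂ : Type*} [Field k] [IsAlgClosed k]
    [CharZero k] [Group A] [Group B] [Finite A] [Finite B]
    [AddCommGroup V] [Module k V] [FiniteDimensional k V]
    [AddCommGroup V₁] [Module k V₁] [FiniteDimensional k V₁]
    [AddCommGroup V₂] [Module k V₂] [FiniteDimensional k V₂]
    {ρ : Representation k (A × B) V} {ρ₁ : Representation k A V₁} {ρ₂ : Representation k B V₂}
    (hρ : ρ.IsIrreducible) (hρ₁ : ρ₁.IsIrreducible) (hρ₂ : ρ₂.IsIrreducible)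
    {ζ₁ : Subgroup.center A →* kˣ} {ζ₂ : Subgroup.center B →* kˣ}
    (hζ₁ : Function.Injective ζ₁) (hζ₂ : Function.Injective ζ₂)
    (hcomm₁ : ∀ x y : A, x * y * x⁻¹ * y⁻¹ ∈ Subgroup.center A)
    (hcomm₂ : ∀ x y : B, x * y * x⁻¹ * y⁻¹ ∈ Subgroup.center B)
    (h₁ : ∀ (z : Subgroup.center A) (w : V₁), ρ₁ z w = (ζ₁ z : k) • w)
    (h₂ : ∀ (z : Subgroup.center B) (w : V₂), ρ₂ z w = (ζ₂ z : k) • w)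
    (h : ∀ (a : Subgroup.center A) (b : Subgroup.center B) (w : V),
      ρ (a, b) w = ((ζ₁ a * ζ₂ b : kˣ) : k) • w) :
    Nonempty (Equiv ρ (tprod (ρ₁.comp (MonoidHom.fst A B)) (ρ₂.comp (MonoidHom.snd A B)))) := by
  classical
  have := Fintype.ofFinite A
  have := Fintype.ofFinite B
  set σ := tprod (ρ₁.comp (MonoidHom.fst A B)) (ρ₂.comp (MonoidHom.snd A B))
  set d := Module.finrank k V
  set d₁ := Module.finrank k V₁
  set d₂ := Module.finrank k V₂
  have hcard : (Nat.card (A × B) : k) ≠ 0 := Nat.cast_ne_zero.2 Nat.card_pos.ne'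
  have := invertibleOfNonzero hcard
  have hterm (g : A × B) : σ.character g * ρ.character g⁻¹ =
      if g.1 ∈ Subgroup.center A ∧ g.2 ∈ Subgroup.center B then (d₁ * d₂ * d : k) else 0 := by
    have hσg : σ.character g = ρ₁.character g.1 * ρ₂.character g.2 :=
      congrFun (char_tensor _ _) g
    rw [hσg]
    split_ifs with hg
    · obtain ⟨ha, hb⟩ := hg
      set a : Subgroup.center A := ⟨g.1, ha⟩
      set b : Subgroup.center B := ⟨g.2, hb⟩
      have h1 : ρ₁.character g.1 = ζ₁ a * d₁ := character_center h₁ a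
      have h2 : ρ₂.character g.2 = ζ₂ b * d₂ := character_center h₂ b
      have h3 : ρ g⁻¹ = ((ζ₁ a⁻¹ * ζ₂ b⁻¹ : kˣ) : k) • LinearMap.id :=
        LinearMap.ext (h a⁻¹ b⁻¹)
      rw [h1, h2, character, h3, map_smul, LinearMap.trace_id, smul_eq_mul, map_inv, map_inv]
      simp only [Units.val_mul, Units.val_inv_eq_inv_val]
      have := (ζ₁ a).ne_zero
      have := (ζ₂ b).ne_zero
      field_simp
      rfl
    · rw [not_and_or] at hg
      rcases hg with hg | hg
      · rw [character_eq_zero_of_notMem_center hζ₁ hcomm₁ h₁ hg, zero_mul, zero_mul]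
      · rw [character_eq_zero_of_notMem_center hζ₂ hcomm₂ h₂ hg, mul_zero, zero_mul]
  have hsum := card_inv_mul_sum_char_mul_char_eq_finrank ρ σ
  set n := Module.finrank k (IntertwiningMap ρ σ)
  have hcenter : (Finset.univ.filter fun g : A × B ↦
      g.1 ∈ Subgroup.center A ∧ g.2 ∈ Subgroup.center B).card =
      Nat.card (Subgroup.center A) * Nat.card (Subgroup.center B) := by
    rw [Finset.univ_product_univ.symm, Finset.filter_product, Finset.card_product,
      Nat.card_eq_fintype_card, Nat.card_eq_fintype_card, Fintype.card_subtype,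
      Fintype.card_subtype]
  rw [inv_mul_eq_iff_eq_mul₀ hcard] at hsum
  simp only [hterm, ← Finset.sum_filter, Finset.sum_const, nsmul_eq_mul, hcenter] at hsum
  have hsum : Nat.card (Subgroup.center A) * Nat.card (Subgroup.center B) * (d₁ * d₂ * d) =
      Nat.card (A × B) * n := by exact_mod_cast hsum
  rw [Nat.card_prod, ← hρ₁.finrank_sq_mul_card_center hζ₁ hcomm₁ h₁,
    ← hρ₂.finrank_sq_mul_card_center hζ₂ hcomm₂ h₂] at hsum
  have hV : Nontrivial V := by
    by_contra hV
    rw [not_nontrivial_iff_subsingleton] at hV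
    exact bot_ne_top (Subrepresentation.toSubmodule_injective (Subsingleton.elim
      (⊥ : Subrepresentation ρ).toSubmodule (⊤ : Subrepresentation ρ).toSubmodule))
  have hV₁ : 0 < d₁ := Nat.pos_of_ne_zero fun h0 ↦ by
    have := hρ₁.finrank_sq_mul_card_center hζ₁ hcomm₁ h₁
    change d₁ ^ 2 * _ = _ at this
    rw [h0] at this
    have := Nat.card_pos (α := A)
    omega
  have hV₂ : 0 < d₂ := Nat.pos_of_ne_zero fun h0 ↦ by
    have := hρ₂.finrank_sq_mul_card_center hζ₂ hcomm₂ h₂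
    change d₂ ^ 2 * _ = _ at this
    rw [h0] at this
    have := Nat.card_pos (α := B)
    omega
  have hd : 0 < d := Module.finrank_pos
  have hdim : d = d₁ * d₂ * n := by
    have hpos : 0 < Nat.card (Subgroup.center A) * Nat.card (Subgroup.center B) * (d₁ * d₂) := by
      have := Nat.card_pos (α := Subgroup.center A)
      have := Nat.card_pos (α := Subgroup.center B)
      positivity
    refine Nat.eq_of_mul_eq_mul_left hpos ?_
    rw [mul_assoc, hsum]
    ring
  have hnpos : 0 < n := Nat.pos_of_ne_zero fun h0 ↦ by simp [h0] at hdim; omega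
  obtain ⟨f, hf⟩ := Module.finrank_pos_iff_exists_ne_zero.1 hnpos
  have hinj : Function.Injective f := (IsIrreducible.injective_or_eq_zero f).resolve_right hf
  have hle : d ≤ Module.finrank k (TensorProduct k V₁ V₂) :=
    LinearMap.finrank_le_finrank_of_injective (f := f.toLinearMap) hinj
  have hdeq : d = Module.finrank k (TensorProduct k V₁ V₂) := by
    refine hle.antisymm ?_
    rw [Module.finrank_tensorProduct, hdim]
    exact Nat.le_mul_of_pos_right _ hnpos
  exact ⟨f.ofBijective ⟨hinj,
    (LinearMap.injective_iff_surjective_of_finrank_eq_finrank (f := f.toLinearMap) hdeq).1 hinj⟩⟩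

end Representation

namespace Subgroup

variable {G : Type*} [Group G] {H K : Subgroup G}

theorem center_eq_subgroupOf_of_commute (hHK : ∀ x ∈ H, ∀ y ∈ K, Commute x y)
    (hmul : ∀ g : G, ∃ x ∈ H, ∃ y ∈ K, x * y = g) : center H = (center G).subgroupOf H := by
  ext x
  rw [mem_subgroupOf, mem_center_iff, mem_center_iff]
  refine ⟨fun h g ↦ ?_, fun h y ↦ Subtype.ext (h y)⟩
  obtain ⟨a, ha, b, hb, rfl⟩ := hmul g
  have hax : Commute a x := congrArg Subtype.val (h ⟨a, ha⟩)
  exact hax.mul_left (hHK x x.2 b hb).symm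

/-- The inclusion of `center H` into `center G`, when `center H` consists of central elements
of `G`. -/
def centerInclusion (h : center H = (center G).subgroupOf H) : center H →* center G :=
  (H.subtype.comp (center H).subtype).codRestrict (center G) fun x ↦
    mem_subgroupOf.1 (h ▸ x.2)

theorem centerInclusion_injective (h : center H = (center G).subgroupOf H) :
    Function.Injective (centerInclusion h) := fun _ _ hxy ↦
  Subtype.ext (Subtype.ext (congrArg (fun z : center G ↦ (z : G)) hxy))

theorem commutator_mem_center_of_eq (h : center H = (center G).subgroupOf H)
    (hcomm : ∀ x y : G, x * y * x⁻¹ * y⁻¹ ∈ center G) (x y : H) :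
    x * y * x⁻¹ * y⁻¹ ∈ center H := by
  rw [h]
  exact hcomm x y

/-- A factor of a central product inherits from the whole group a cyclic centre and an elementary
abelian central quotient. -/
theorem isCyclic_center_and_quotient_of_center_eq {n : ℕ} (h : center H = (center G).subgroupOf H)
    (hcyc : IsCyclic (center G)) (hpow : ∀ x : G ⧸ center G, x ^ n = 1)
    (habel : ∀ x y : G ⧸ center G, Commute x y) (hH : ¬ H ≤ center G) :
    center H = (center G).subgroupOf H ∧ IsCyclic (center H) ∧ center H ≠ ⊤ ∧
      (∀ x : H ⧸ center H, x ^ n = 1) ∧ ∀ x y : H ⧸ center H, Commute x y := by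
  refine ⟨h, isCyclic_of_injective _ (centerInclusion_injective h), ?_, fun x ↦ ?_, fun x y ↦ ?_⟩
  · rwa [h, Ne, subgroupOf_eq_top]
  · obtain ⟨a, rfl⟩ := QuotientGroup.mk_surjective x
    have ha := hpow (a : G)
    rw [← QuotientGroup.mk_pow, QuotientGroup.eq_one_iff] at ha ⊢
    rwa [h]
  · obtain ⟨a, rfl⟩ := QuotientGroup.mk_surjective x
    obtain ⟨b, rfl⟩ := QuotientGroup.mk_surjective y
    refine QuotientGroup.eq.2 ?_
    rw [h]
    have hab : ((a * b : G) : G ⧸ center G) = ((b * a : G) : G ⧸ center G) := habel a b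
    rw [QuotientGroup.eq] at hab
    exact hab

end Subgroup

theorem not_centerPreimage_le_center {P : Type*} [Group P]
    {V : Subgroup (P ⧸ Subgroup.center P)} (hV : V ≠ ⊥) :
    ¬ centerPreimage V ≤ Subgroup.center P := fun h ↦
  hV <| (Subgroup.eq_bot_iff_forall _).2 fun x hx ↦ by
    obtain ⟨a, rfl⟩ := QuotientGroup.mk_surjective x
    exact (QuotientGroup.eq_one_iff a).2 (h hx)

theorem exists_mul_eq_of_sup_eq_top {P : Type*} [Group P]
    {V₁ V₂ : Subgroup (P ⧸ Subgroup.center P)} [V₂.Normal] (hsup : V₁ ⊔ V₂ = ⊤) (g : P) :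
    ∃ x ∈ centerPreimage V₁, ∃ y ∈ centerPreimage V₂, x * y = g := by
  have hg : (g : P ⧸ Subgroup.center P) ∈ V₁ ⊔ V₂ := hsup ▸ Subgroup.mem_top _
  obtain ⟨v₁, h₁, v₂, h₂, hv⟩ := Subgroup.mem_sup_of_normal_right.1 hg
  obtain ⟨a, rfl⟩ := QuotientGroup.mk_surjective v₁
  refine ⟨a, h₁, a⁻¹ * g, ?_, mul_inv_cancel_left a g⟩
  change ((a⁻¹ * g : P) : P ⧸ Subgroup.center P) ∈ V₂
  rwa [QuotientGroup.mk_mul, ← hv, QuotientGroup.mk_inv, inv_mul_cancel_left]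

/-- an orthogonal decomposition of `P ⧸ Z` with respect to the
commutator form yields a central product decomposition of `P` and a tensor
decomposition of the irreducible representation containing `ζ`. -/
theorem stmt_6 (p : ℕ) (hp : p.Prime) (P : Type) [Group P] [Fintype P]
    (hP : IsPGroup p P)
    (hZcyc : IsCyclic (Subgroup.center P))
    (hZne : Subgroup.center P ≠ ⊤)
    (helem : ∀ x : P ⧸ Subgroup.center P, x ^ p = 1)
    (habel : ∀ x y : P ⧸ Subgroup.center P, Commute x y)
    (hcomm : ∀ x y : P, x * y * x⁻¹ * y⁻¹ ∈ Subgroup.center P)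
    (ζ : Subgroup.center P →* ℂˣ) (hζ : Function.Injective ζ)
    -- V = V₁ ⊕ V₂, an orthogonal decomposition into nonzero subgroups
    (V₁ V₂ : Subgroup (P ⧸ Subgroup.center P))
    (hV₁ : V₁ ≠ ⊥) (hV₂ : V₂ ≠ ⊥)
    (hsup : V₁ ⊔ V₂ = ⊤) (hinf : V₁ ⊓ V₂ = ⊥)
    (horth : ∀ x y : P, (↑x : P ⧸ Subgroup.center P) ∈ V₁ →
      (↑y : P ⧸ Subgroup.center P) ∈ V₂ → ζ ⟨x * y * x⁻¹ * y⁻¹, hcomm x y⟩ = 1)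
    -- the centre is contained in both preimages
    (hZ₁ : Subgroup.center P ≤ centerPreimage V₁)
    (hZ₂ : Subgroup.center P ≤ centerPreimage V₂) :
    -- (1) P₁ commutes with P₂ elementwise
    (∀ x y : P, x ∈ centerPreimage V₁ → y ∈ centerPreimage V₂ → Commute x y) ∧
    -- (2) each Pᵢ is H-cyclic with centre Z
    (Subgroup.center (centerPreimage V₁) =
        (Subgroup.center P).subgroupOf (centerPreimage V₁) ∧
      IsCyclic (Subgroup.center (centerPreimage V₁)) ∧
      Subgroup.center (centerPreimage V₁) ≠ ⊤ ∧
      (∀ x : centerPreimage V₁ ⧸ Subgroup.center (centerPreimage V₁), x ^ p = 1) ∧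
      (∀ x y : centerPreimage V₁ ⧸ Subgroup.center (centerPreimage V₁), Commute x y)) ∧
    (Subgroup.center (centerPreimage V₂) =
        (Subgroup.center P).subgroupOf (centerPreimage V₂) ∧
      IsCyclic (Subgroup.center (centerPreimage V₂)) ∧
      Subgroup.center (centerPreimage V₂) ≠ ⊤ ∧
      (∀ x : centerPreimage V₂ ⧸ Subgroup.center (centerPreimage V₂), x ^ p = 1) ∧
      (∀ x y : centerPreimage V₂ ⧸ Subgroup.center (centerPreimage V₂), Commute x y)) ∧
    -- (3) the multiplication map π : P₁ × P₂ → P is a surjective homomorphism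
    -- with kernel {(z, z⁻¹) : z ∈ Z}, and (4) τ ∘ π ≅ τ₁ ⊗ τ₂
    (∃ π : ↥(centerPreimage V₁) × ↥(centerPreimage V₂) →* P,
      (∀ (a : centerPreimage V₁) (b : centerPreimage V₂), π (a, b) = (a : P) * (b : P)) ∧
      Function.Surjective π ∧
      (∀ x : ↥(centerPreimage V₁) × ↥(centerPreimage V₂),
        x ∈ π.ker ↔ ∃ (z : P) (hz : z ∈ Subgroup.center P),
          (x.1 : P) = z ∧ (x.2 : P) = z⁻¹) ∧
      (∀ (τ : FDRep ℂ P) (τ₁ : FDRep ℂ (centerPreimage V₁))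
          (τ₂ : FDRep ℂ (centerPreimage V₂)),
        Simple τ →
        (∃ v : τ, v ≠ 0 ∧ ∀ z : Subgroup.center P, τ.ρ (z : P) v = (ζ z : ℂ) • v) →
        Simple τ₁ →
        (∃ v : τ₁, v ≠ 0 ∧ ∀ z : Subgroup.center P,
          τ₁.ρ ⟨(z : P), hZ₁ z.2⟩ v = (ζ z : ℂ) • v) →
        Simple τ₂ →
        (∃ v : τ₂, v ≠ 0 ∧ ∀ z : Subgroup.center P,
          τ₂.ρ ⟨(z : P), hZ₂ z.2⟩ v = (ζ z : ℂ) • v) →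
        ∃ e : τ ≃ₗ[ℂ] TensorProduct ℂ τ₁ τ₂,
          ∀ (g : ↥(centerPreimage V₁) × ↥(centerPreimage V₂))
            (v : τ),
            e (τ.ρ (π g) v) =
              Representation.tprod
                (τ₁.ρ.comp (MonoidHom.fst (centerPreimage V₁) (centerPreimage V₂)))
                (τ₂.ρ.comp (MonoidHom.snd (centerPreimage V₁) (centerPreimage V₂)))
                g (e v))) := by
  have hHK (x y : P) (hx : x ∈ centerPreimage V₁) (hy : y ∈ centerPreimage V₂) : Commute x y := by
    have h1 := congrArg Subtype.val (hζ ((horth x y hx hy).trans (map_one ζ).symm))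
    have h1 : x * y * x⁻¹ * y⁻¹ = 1 := h1
    rwa [mul_inv_eq_one, mul_inv_eq_iff_eq_mul] at h1
  have hnormal : V₂.Normal := ⟨fun n hn g ↦ by rwa [(habel g n).eq, mul_inv_cancel_right]⟩
  have hmul := exists_mul_eq_of_sup_eq_top hsup
  have hc₁ := Subgroup.center_eq_subgroupOf_of_commute (fun x hx y hy ↦ hHK x y hx hy) hmul
  have hc₂ := Subgroup.center_eq_subgroupOf_of_commute
    (fun x hx y hy ↦ (hHK y x hy hx).symm) fun g ↦ by
      obtain ⟨x, hx, y, hy, rfl⟩ := hmul g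
      exact ⟨y, hy, x, hx, (hHK x y hx hy).symm⟩
  let π : ↥(centerPreimage V₁) × ↥(centerPreimage V₂) →* P :=
    MonoidHom.noncommCoprod (centerPreimage V₁).subtype (centerPreimage V₂).subtype
      fun a b ↦ hHK a b a.2 b.2
  have hπ (a : centerPreimage V₁) (b : centerPreimage V₂) : π (a, b) = (a : P) * (b : P) := rfl
  have hπsurj : Function.Surjective π := fun g ↦ by
    obtain ⟨x, hx, y, hy, rfl⟩ := hmul g
    exact ⟨(⟨x, hx⟩, ⟨y, hy⟩), rfl⟩
  refine ⟨hHK,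
    Subgroup.isCyclic_center_and_quotient_of_center_eq hc₁ hZcyc helem habel
      (not_centerPreimage_le_center hV₁),
    Subgroup.isCyclic_center_and_quotient_of_center_eq hc₂ hZcyc helem habel
      (not_centerPreimage_le_center hV₂),
    π, hπ, hπsurj, fun ⟨a, b⟩ ↦ ?_, ?_⟩
  · rw [MonoidHom.mem_ker, hπ]
    constructor
    · intro hab
      have hb : (b : P) = (a : P)⁻¹ := eq_inv_of_mul_eq_one_right hab
      refine ⟨a, ?_, rfl, hb⟩
      rw [← QuotientGroup.eq_one_iff, ← Subgroup.mem_bot, ← hinf]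
      refine ⟨a.2, ?_⟩
      have ha : (a : P) ∈ centerPreimage V₂ := by
        rw [← inv_inv (a : P), ← hb]
        exact inv_mem b.2
      exact ha
    · rintro ⟨z, -, ha, hb⟩
      rw [ha, hb, mul_inv_cancel]
  · rintro τ τ₁ τ₂ hτ ⟨v, hv, hvζ⟩ hτ₁ ⟨v₁, hv₁, hvζ₁⟩ hτ₂ ⟨v₂, hv₂, hvζ₂⟩
    let i₁ := Subgroup.centerInclusion hc₁
    let i₂ := Subgroup.centerInclusion hc₂
    have hirr := FDRep.isIrreducible_of_simple τ
    have hirr₁ := FDRep.isIrreducible_of_simple τ₁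
    have hirr₂ := FDRep.isIrreducible_of_simple τ₂
    have hτζ := hirr.apply_center_eq_smul (ζ := fun z ↦ (ζ z : ℂ)) hv hvζ
    obtain ⟨e⟩ := (hirr.comp_of_surjective hπsurj).nonempty_equiv_tprod hirr₁ hirr₂
      (ζ₁ := ζ.comp i₁) (ζ₂ := ζ.comp i₂)
      (hζ.comp (Subgroup.centerInclusion_injective hc₁))
      (hζ.comp (Subgroup.centerInclusion_injective hc₂))
      (Subgroup.commutator_mem_center_of_eq hc₁ hcomm)
      (Subgroup.commutator_mem_center_of_eq hc₂ hcomm)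
      (hirr₁.apply_center_eq_smul (ζ := fun z ↦ (ζ (i₁ z) : ℂ)) hv₁ fun z ↦ hvζ₁ (i₁ z))
      (hirr₂.apply_center_eq_smul (ζ := fun z ↦ (ζ (i₂ z) : ℂ)) hv₂ fun z ↦ hvζ₂ (i₂ z))
      (fun a b w ↦ by
        have := hτζ (i₁ a * i₂ b) w
        rw [map_mul] at this
        exact this)
    exact ⟨e.toLinearEquiv, fun g w ↦ LinearMap.congr_fun (e.toIntertwiningMap.isIntertwining' g) w⟩
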